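/- Suppose n ≥ 3, k = pn + 2 for some p ≥ 1, and R*(n+1) > RD*(n+2). Then the k-visit walk formed by concatenating (a rotation of) an optimal (n+2)-visit PMP-D walk WD*(n+2) with p−1 copies of the n-visit cycle obtained by shortcutting both the repeated target and the depot from WD*(n+2) is a feasible PMP-D walk whose revisit time equals RD*(n+2), and RD*(pn+2) = RD*(n+2). -/

import Mathlib

/-- Total cost of consecutive steps of a finite sequence of vertices. -/
def chainCost {V : Type*} (c : V → V → ℝ) : List V → ℝ
  | [] => 0
  | [_] => 0
  | x :: y :: t => c x y + chainCost c (y :: t)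

/-- A depot-free spanning revisit sequence with `v` visits, written as a list
`(u_0, ..., u_{v-1}, u_0)`: length `v+1`, cyclically closed, consecutive elements
distinct, all elements targets, covering all targets. -/
def IsRevSeqND {V : Type*} (N : Finset V) (v : ℕ) (l : List V) : Prop :=
  l.length = v + 1 ∧ l.head? = l.getLast? ∧ l.Chain' (· ≠ ·) ∧
    (∀ x ∈ l, x ∈ N) ∧ (∀ t ∈ N, t ∈ l)

/-- A depot-containing spanning revisit sequence with `v` visits, written as a list
`(u_0, ..., u_{v-1}, u_0)`: starts and ends at the same target, consecutive elements
distinct, elements in `N ∪ {d}`, covering all targets, depot appearing exactly once. -/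
def IsRevSeqD {V : Type*} [DecidableEq V] (N : Finset V) (d : V) (v : ℕ) (l : List V) : Prop :=
  l.length = v + 1 ∧ l.head? = l.getLast? ∧ l.Chain' (· ≠ ·) ∧
    (∀ x ∈ l, x ∈ N ∨ x = d) ∧ (∀ t ∈ N, t ∈ l) ∧ l.count d = 1 ∧
    (∃ u ∈ N, l.head? = some u)
/-- Cost of the stretch of the (periodically extended) walk `f` from index `i` to `j`. -/
noncomputable def segCost {V : Type*} (c : V → V → ℝ) (f : ℕ → V) (i j : ℕ) : ℝ :=
  ∑ m ∈ Finset.range (j - i), c (f (i + m)) (f (i + m + 1))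

/-- Indices `i < j` are consecutive occurrences of the terminus `f i` in the walk `f`. -/
def IsRevisit {V : Type*} (f : ℕ → V) (i j : ℕ) : Prop :=
  i < j ∧ f j = f i ∧ ∀ m, i < m → m < j → f m ≠ f i

/-- The stretch of `f` from `i` to `j` visits every target in `N`. -/
def Spans {V : Type*} (N : Finset V) (f : ℕ → V) (i j : ℕ) : Prop :=
  ∀ t ∈ N, ∃ m, i ≤ m ∧ m ≤ j ∧ f m = t

/-- The stretch of `f` from `i` to `j` visits the depot. -/
def HasDepot {V : Type*} (dV : V) (f : ℕ → V) (i j : ℕ) : Prop :=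
  ∃ m, i ≤ m ∧ m ≤ j ∧ f m = dV

/-- The set of travel times of all spanning revisit sequences (with a target terminus,
starting within one period `p`) of the periodic walk `f`. The revisit time of the walk
is the greatest element of this set. -/
def revCosts {V : Type*} (c : V → V → ℝ) (N : Finset V) (p : ℕ) (f : ℕ → V) : Set ℝ :=
  {x | ∃ i j, i < p ∧ f i ∈ N ∧ IsRevisit f i j ∧ Spans N f i j ∧ x = segCost c f i j}

/-- A PMP walk with `v` visits, modelled as its periodic extension: period `v`,
consecutive visits distinct, all visits are targets, every target visited in a period. -/
def IsPMPWalkFun {V : Type*} (N : Finset V) (v : ℕ) (f : ℕ → V) : Prop :=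
  (∀ i, f (i + v) = f i) ∧ (∀ i, f i ≠ f (i + 1)) ∧
    (∀ i, f i ∈ N) ∧ (∀ t ∈ N, ∃ i, i < v ∧ f i = t)

/-- A PMP-D walk with `k` visits, modelled as its periodic extension: period `k`,
starts at the depot, the depot is visited exactly once per period, consecutive visits
distinct, visits in `N ∪ {d}`, every target visited in a period. -/
def IsPMPDWalkFun {V : Type*} (N : Finset V) (dV : V) (k : ℕ) (f : ℕ → V) : Prop :=
  (∀ i, f (i + k) = f i) ∧ (∀ i, f i ≠ f (i + 1)) ∧
    (∀ i, f i = dV ↔ k ∣ i) ∧ (∀ i, f i ∈ N ∨ f i = dV) ∧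
    (∀ t ∈ N, ∃ i, i < k ∧ f i = t)

/-- The set of revisit times of PMP-D walks with `m` visits; `RD*(m)` is its least element. -/
def pmpdRevTimes {V : Type*} (c : V → V → ℝ) (N : Finset V) (dV : V) (m : ℕ) : Set ℝ :=
  {r | ∃ f : ℕ → V, IsPMPDWalkFun N dV m f ∧ IsGreatest (revCosts c N m f) r}

/-- The set of revisit times of PMP walks with `m` visits; `R*(m)` is its least element. -/
def pmpRevTimes {V : Type*} (c : V → V → ℝ) (N : Finset V) (m : ℕ) : Set ℝ :=
  {r | ∃ f : ℕ → V, IsPMPWalkFun N m f ∧ IsGreatest (revCosts c N m f) r}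

section ChainCost

variable {V : Type*} {c : V → V → ℝ}

lemma chainCost_split (x : V) (l₂ : List V) :
    ∀ l₁ : List V,
      chainCost c (l₁ ++ x :: l₂) = chainCost c (l₁ ++ [x]) + chainCost c (x :: l₂)
  | [] => by simp [chainCost]
  | [a] => by simp [chainCost]
  | a :: b :: l₁ => by
    have := chainCost_split x l₂ (b :: l₁)
    simp only [List.cons_append, chainCost] at this ⊢
    linarith

lemma chainCost_cons_concat_le_cons (htri : ∀ x y z, c x z ≤ c x y + c y z) (x a y : V)
    (l : List V) : chainCost c (x :: l ++ [y]) ≤ chainCost c (x :: a :: l ++ [y]) := by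
  cases l with
  | nil => simpa [chainCost] using htri x a y
  | cons b l =>
    simp only [List.cons_append, chainCost]
    linarith [htri x a b]

/-- Shortcutting interior vertices does not increase the cost. -/
lemma chainCost_sublist_le (htri : ∀ x y z, c x z ≤ c x y + c y z) {l₁ l₂ : List V}
    (h : l₁.Sublist l₂) (x y : V) :
    chainCost c (x :: l₁ ++ [y]) ≤ chainCost c (x :: l₂ ++ [y]) := by
  induction h generalizing x with
  | slnil => exact le_rfl
  | cons a _ ih => exact (ih x).trans (chainCost_cons_concat_le_cons htri x a y _)
  | cons_cons a _ ih =>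
    have := ih a
    simp only [List.cons_append, chainCost] at this ⊢
    linarith

/-- The cost of a closed walk does not depend on its starting point. -/
lemma chainCost_rotate (d x : V) (P Q : List V) :
    chainCost c (x :: (Q ++ d :: P) ++ [x]) = chainCost c (d :: (P ++ x :: Q) ++ [d]) := by
  have h₁ := chainCost_split (c := c) d (P ++ [x]) (x :: Q)
  have h₂ := chainCost_split (c := c) x (Q ++ [d]) (d :: P)
  simp only [List.cons_append, List.append_assoc] at h₁ h₂ ⊢
  linarith

lemma isChain_rotate {R : V → V → Prop} {d x : V} {P Q : List V}
    (h : List.IsChain R (d :: (P ++ x :: Q) ++ [d])) :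
    List.IsChain R (x :: (Q ++ d :: P) ++ [x]) := by
  have h₁ := (List.isChain_split (R := R) (c := x) (l₁ := d :: P) (l₂ := Q ++ [d])).1
    (by simpa using h)
  have h₂ := (List.isChain_split (R := R) (c := d) (l₁ := x :: Q) (l₂ := P ++ [x])).2
    ⟨by simpa using h₁.2, by simpa using h₁.1⟩
  simpa using h₂

lemma isChain_cons_concat {x : V} {l : List V} (hl : l.IsChain (· ≠ ·)) (hne : l ≠ [])
    (hx : x ∉ l) : (x :: l ++ [x]).IsChain (· ≠ ·) := by
  rw [List.cons_append, List.isChain_cons, List.isChain_append]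
  refine ⟨fun y hy => ?_, hl, List.isChain_singleton _, fun z hz y hy => ?_⟩
  · rintro rfl
    rw [List.head?_append_of_ne_nil _ hne] at hy
    exact hx (List.mem_of_mem_head? hy)
  · rintro rfl
    obtain rfl : x = z := by simpa using hy
    exact hx (List.mem_of_mem_getLast? hz)

/-- A list with a repetition has a sublist with the same elements and exactly one repetition;
adjacent elements can be kept distinct. -/
lemma exists_sublist_length_eq_card_add_one [DecidableEq V] {l : List V}
    (hl : l.IsChain (· ≠ ·)) (hdup : ¬ l.Nodup) :
    ∃ l' : List V, l'.Sublist l ∧ l'.IsChain (· ≠ ·) ∧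
      l'.length = l.toFinset.card + 1 ∧ l'.toFinset = l.toFinset := by
  induction l with
  | nil => simp at hdup
  | cons a l ih =>
    by_cases hnd : l.Nodup
    · have ha : a ∈ l := by
        by_contra ha
        exact hdup (List.nodup_cons.2 ⟨ha, hnd⟩)
      refine ⟨a :: l, List.Sublist.refl _, hl, ?_, rfl⟩
      have : insert a l.toFinset = l.toFinset := Finset.insert_eq_of_mem (by simpa using ha)
      rw [List.toFinset_cons, this, List.toFinset_card_of_nodup hnd, List.length_cons]
    · obtain ⟨l', hsub, hch, hlen, heq⟩ := ih (List.isChain_cons.1 hl).2 hnd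
      by_cases ha : a ∈ l
      · have : insert a l.toFinset = l.toFinset := Finset.insert_eq_of_mem (by simpa using ha)
        exact ⟨l', hsub.cons a, hch, by rw [List.toFinset_cons, this, hlen],
          by rw [List.toFinset_cons, this, heq]⟩
      · refine ⟨a :: l', hsub.cons_cons a, List.isChain_cons.2 ⟨?_, hch⟩, ?_, ?_⟩
        · rintro y hy rfl
          exact ha (hsub.subset (List.mem_of_mem_head? hy))
        · rw [List.toFinset_cons, Finset.card_insert_of_notMem (by simpa using ha),
            List.length_cons, hlen]
        · rw [List.toFinset_cons, List.toFinset_cons, heq]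

/-- Removing duplicates from a list, split at the last occurrence of an element. -/
lemma exists_dedup_append_cons [DecidableEq V] {x : V} (P : List V) {Q : List V} (hx : x ∉ Q) :
    ∃ P' Q' : List V, (P ++ x :: Q).dedup = P' ++ x :: Q' ∧ P'.Sublist P ∧ Q'.Sublist Q := by
  induction P with
  | nil =>
    exact ⟨[], Q.dedup, by simp [List.dedup_cons_of_notMem hx], List.Sublist.refl _,
      List.dedup_sublist Q⟩
  | cons a P ih =>
    obtain ⟨P', Q', h, hP, hQ⟩ := ih
    by_cases ha : a ∈ P ++ x :: Q
    · exact ⟨P', Q', by rw [List.cons_append, List.dedup_cons_of_mem ha, h], hP.cons a, hQ⟩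
    · exact ⟨a :: P', Q', by rw [List.cons_append, List.dedup_cons_of_notMem ha, h]; rfl,
        hP.cons_cons a, hQ⟩

end ChainCost

section Segment

variable {V : Type*}

/-- The `n` consecutive visits of `f` starting at index `i`. -/
def stretch (f : ℕ → V) (i n : ℕ) : List V := (List.range' i n).map f

@[simp]
lemma length_stretch (f : ℕ → V) (i n : ℕ) : (stretch f i n).length = n := by simp [stretch]

lemma stretch_succ (f : ℕ → V) (i n : ℕ) :
    stretch f i (n + 1) = f i :: stretch f (i + 1) n := rfl

lemma stretch_add (f : ℕ → V) (i m n : ℕ) :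
    stretch f i (m + n) = stretch f i m ++ stretch f (i + m) n := by
  rw [stretch, ← List.range'_append_1, List.map_append]
  rfl

lemma mem_stretch {f : ℕ → V} {i n : ℕ} {x : V} :
    x ∈ stretch f i n ↔ ∃ m, i ≤ m ∧ m < i + n ∧ f m = x := by
  simp [stretch, List.mem_range'_1, and_assoc]

lemma getElem_stretch (f : ℕ → V) (i n m : ℕ) (hm : m < (stretch f i n).length) :
    (stretch f i n)[m] = f (i + m) := by
  simp [stretch]

lemma ofFn_eq_stretch (f : ℕ → V) (i n : ℕ) :
    (List.ofFn fun m : Fin n => f (i + m.val)) = stretch f i n := by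
  apply List.ext_getElem <;> simp [stretch]

lemma stretch_congr {f g : ℕ → V} {i j n : ℕ} (h : ∀ m < n, f (i + m) = g (j + m)) :
    stretch f i n = stretch g j n := by
  apply List.ext_getElem (by simp)
  intro m h₁ h₂
  rw [getElem_stretch, getElem_stretch]
  exact h m (by simpa using h₁)

lemma stretch_eq_append {f : ℕ → V} {i n : ℕ} {A B : List V} (h : stretch f i n = A ++ B) :
    stretch f i A.length = A ∧ stretch f (i + A.length) B.length = B := by
  have hn : n = A.length + B.length := by simpa using congrArg List.length h
  rw [hn, stretch_add] at h
  exact List.append_inj h (by simp)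

lemma isChain_stretch {f : ℕ → V} (h : ∀ i, f i ≠ f (i + 1)) (i n : ℕ) :
    (stretch f i n).IsChain (· ≠ ·) := by
  rw [List.isChain_iff_getElem]
  intro m hm
  rw [getElem_stretch, getElem_stretch]
  exact h (i + m)

lemma segCost_eq_chainCost (c : V → V → ℝ) (f : ℕ → V) (i n : ℕ) :
    segCost c f i (i + n) = chainCost c (stretch f i (n + 1)) := by
  induction n generalizing i with
  | zero => simp [segCost, stretch, chainCost]
  | succ n ih =>
    have := ih (i + 1)
    rw [stretch_succ, stretch_succ, chainCost, ← stretch_succ, ← this]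
    simp only [segCost, Nat.add_sub_cancel_left]
    rw [Finset.sum_range_succ']
    simp only [Nat.add_zero]
    rw [add_comm]
    congr 1
    refine Finset.sum_congr rfl fun m _ => ?_
    rw [show i + (m + 1) = i + 1 + m by omega]

lemma segCost_mono {c : V → V → ℝ} (hnonneg : ∀ x y, 0 ≤ c x y) (f : ℕ → V) (i : ℕ) {j j' : ℕ}
    (h : j ≤ j') : segCost c f i j ≤ segCost c f i j' :=
  Finset.sum_le_sum_of_subset_of_nonneg (Finset.range_subset_range.2 (by omega))
    fun _ _ _ => hnonneg _ _

/-- The stretch between two equal visits in two adjacent stretches of a walk. -/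
lemma stretch_append_cons {f : ℕ → V} {i : ℕ} {P₁ Q₁ P₂ Q₂ : List V} {x : V}
    (h₁ : stretch f i (P₁ ++ x :: Q₁).length = P₁ ++ x :: Q₁)
    (h₂ : stretch f (i + (P₁ ++ x :: Q₁).length) (P₂ ++ x :: Q₂).length = P₂ ++ x :: Q₂) :
    stretch f (i + P₁.length) ((Q₁ ++ P₂).length + 2) = x :: (Q₁ ++ P₂) ++ [x] := by
  have h := stretch_add f i (P₁ ++ x :: Q₁).length (P₂ ++ x :: Q₂).length
  rw [h₁, h₂, show P₁ ++ x :: Q₁ ++ (P₂ ++ x :: Q₂) =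
    P₁ ++ ((x :: (Q₁ ++ P₂) ++ [x]) ++ Q₂) by simp] at h
  rw [show (Q₁ ++ P₂).length + 2 = (x :: (Q₁ ++ P₂) ++ [x]).length by simp [Nat.add_assoc]]
  exact (stretch_eq_append (stretch_eq_append h).2).1

lemma IsRevisit.segCost_le {c : V → V → ℝ} (hnonneg : ∀ x y, 0 ≤ c x y) {f : ℕ → V} {i j : ℕ}
    (h : IsRevisit f i j) {x : V} {l : List V}
    (hl : stretch f i (l.length + 2) = x :: l ++ [x]) :
    segCost c f i j ≤ chainCost c (x :: l ++ [x]) := by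
  have hi : f i = x := (List.cons.inj hl).1
  have hx : f (i + (l.length + 1)) = x := by
    have := getElem_stretch f i (l.length + 2) (l.length + 1) (by simp)
    rw [← this]
    simp [hl]
  rw [← hl, ← segCost_eq_chainCost]
  refine segCost_mono hnonneg f i ?_
  by_contra! hlt
  exact h.2.2 _ (by omega) hlt (hx.trans hi.symm)

end Segment

section Revisit

variable {V : Type*} {N : Finset V} {f : ℕ → V} {v : ℕ}

lemma IsRevisit.sub_le (hper : ∀ i, f (i + v) = f i) (hv : 0 < v) {i j : ℕ}
    (h : IsRevisit f i j) : j ≤ i + v := by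
  by_contra! hlt
  exact h.2.2 _ (by omega) hlt (hper i)

/-- A revisit sequence read as a closed list of visits. -/
lemma IsRevisit.stretch_eq {f : ℕ → V} {i j : ℕ} (h : IsRevisit f i j) (hij : i + 2 ≤ j) :
    stretch f i (j - i + 1) = f i :: stretch f (i + 1) (j - i - 1) ++ [f i] := by
  rw [show j - i + 1 = (j - i - 1 + 1) + 1 by omega, stretch_add, stretch_succ, stretch_succ,
    show i + (j - i - 1 + 1) = j by omega, h.2.1]
  rfl

/-- A stretch missing a target that has maximal length among all such stretches is the interior of
a spanning revisit sequence. -/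
lemma spanning_revisit_of_maximal_gap {M i : ℕ} {t : V}
    (hmax : ∀ x, ∀ u ∈ N, ∃ m, m < M + 1 ∧ f (x + m) = u) (ht : t ∈ N)
    (hmiss : ∀ m < M, f (i + 1 + m) ≠ t) :
    f i = t ∧ IsRevisit f i (i + 1 + M) ∧ Spans N f i (i + 1 + M) := by
  have hi : f i = t := by
    obtain ⟨m, hm, hf⟩ := hmax i t ht
    rcases m with _ | m
    · simpa using hf
    · exact absurd (by rwa [show i + 1 + m = i + (m + 1) by omega]) (hmiss m (by omega))
  have hj : f (i + 1 + M) = t := by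
    obtain ⟨m, hm, hf⟩ := hmax (i + 1) t ht
    obtain rfl | hlt : m = M ∨ m < M := by omega
    · exact hf
    · exact absurd hf (hmiss m hlt)
  refine ⟨hi, ⟨by omega, hj.trans hi.symm, fun m h₁ h₂ => ?_⟩, fun u hu => ?_⟩
  · have := hmiss (m - (i + 1)) (by omega)
    rwa [show i + 1 + (m - (i + 1)) = m by omega, ← hi] at this
  · obtain ⟨m, hm, hf⟩ := hmax i u hu
    exact ⟨i + m, by omega, by omega, hf⟩

/-- Every stretch missing a target is dominated in length by a spanning revisit sequence. -/
lemma exists_spanning_revisit (hper : ∀ i, f (i + v) = f i) (hv : 0 < v)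
    (hcov : ∀ t ∈ N, ∃ i, i < v ∧ f i = t) {x L : ℕ} {t : V} (ht : t ∈ N)
    (hmiss : ∀ m < L, f (x + m) ≠ t) :
    ∃ i j, i < v ∧ f i ∈ N ∧ IsRevisit f i j ∧ Spans N f i j ∧ i + 1 + L ≤ j := by
  classical
  have hmod : ∀ i, f (i % v) = f i := (show Function.Periodic f v from hper).map_mod_nat
  let P : ℕ → Prop := fun L => ∃ x, ∃ t ∈ N, ∀ m < L, f (x + m) ≠ t
  have hbound : ∀ L, P L → L ≤ v := by
    rintro L ⟨x, t, ht, hmiss⟩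
    by_contra! hlt
    obtain ⟨i, hi, hf⟩ := hcov t ht
    have hx := Nat.mod_lt x hv
    have hdm := Nat.div_add_mod x v
    have key : ∀ m, (x + m) % v = i → f (x + m) = t := fun m hm => by rw [← hmod, hm, hf]
    by_cases h : x % v ≤ i
    · refine hmiss (i - x % v) (by omega) (key _ ?_)
      rw [show x + (i - x % v) = i + v * (x / v) by omega, Nat.add_mul_mod_self_left,
        Nat.mod_eq_of_lt hi]
    · refine hmiss (i + v - x % v) (by omega) (key _ ?_)
      rw [show x + (i + v - x % v) = i + v + v * (x / v) by omega, Nat.add_mul_mod_self_left,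
        Nat.add_mod_right, Nat.mod_eq_of_lt hi]
  have hL : P L := ⟨x, t, ht, hmiss⟩
  obtain ⟨y, u, hu, hmissu⟩ : P (Nat.findGreatest P v) :=
    Nat.findGreatest_spec (hbound L hL) hL
  have hLM : L ≤ Nat.findGreatest P v := Nat.le_findGreatest (hbound L hL) hL
  set M := Nat.findGreatest P v
  have hmax : ∀ x, ∀ u ∈ N, ∃ m, m < M + 1 ∧ f (x + m) = u := by
    intro x u hu
    by_contra! h
    have hP : P (M + 1) := ⟨x, u, hu, h⟩
    have : M + 1 ≤ M := Nat.le_findGreatest (hbound _ hP) hP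
    omega
  have hshift : ∀ m, f ((y + v - 1) % v + 1 + m) = f (y + m) := by
    intro m
    rw [← hmod, ← hmod (y + m), add_assoc, Nat.mod_add_mod,
      show y + v - 1 + (1 + m) = y + m + v by omega, Nat.add_mod_right]
  obtain ⟨hi, hrev, hsp⟩ := spanning_revisit_of_maximal_gap hmax hu
    (i := (y + v - 1) % v) fun m hm => by rw [hshift]; exact hmissu m hm
  exact ⟨_, _, Nat.mod_lt _ hv, hi ▸ hu, hrev, hsp, by omega⟩

lemma segCost_add_period (c : V → V → ℝ) (hper : ∀ i, f (i + v) = f i) (i : ℕ) :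
    segCost c f i (i + v) = segCost c f 0 v := by
  induction i with
  | zero => simp
  | succ i ih =>
    rw [← ih]
    simp only [segCost, Nat.add_sub_cancel_left]
    have h₁ := Finset.sum_range_succ (fun m => c (f (i + m)) (f (i + m + 1))) v
    have h₂ := Finset.sum_range_succ' (fun m => c (f (i + m)) (f (i + m + 1))) v
    rw [h₁] at h₂
    have h₃ : f (i + v + 1) = f (i + 1) := by rw [show i + v + 1 = i + 1 + v by omega, hper]
    rw [hper, h₃] at h₂
    simp only [Nat.add_zero] at h₂
    rw [add_left_inj] at h₂
    rw [h₂]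
    refine Finset.sum_congr rfl fun m _ => ?_
    rw [show i + (m + 1) = i + 1 + m by omega]

/-- The revisit time of a walk exists and is at most the cost of a period. -/
lemma exists_isGreatest_revCosts {c : V → V → ℝ} (hnonneg : ∀ x y, 0 ≤ c x y)
    (hper : ∀ i, f (i + v) = f i) (hv : 0 < v)
    (hcov : ∀ t ∈ N, ∃ i, i < v ∧ f i = t) (hN : N.Nonempty) :
    ∃ r, IsGreatest (revCosts c N v f) r ∧ r ≤ segCost c f 0 v := by
  have hfin : (revCosts c N v f).Finite := by
    refine ((Set.finite_Iio v).prod (Set.finite_Iic (v + v))).image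
      (fun q : ℕ × ℕ => segCost c f q.1 q.2) |>.subset ?_
    rintro x ⟨i, j, hi, -, hrev, -, rfl⟩
    have := hrev.sub_le hper hv
    exact ⟨(i, j), ⟨hi, show j ≤ v + v by omega⟩, rfl⟩
  obtain ⟨t, ht⟩ := hN
  obtain ⟨i, j, hi, hiN, hrev, hsp, -⟩ :=
    exists_spanning_revisit hper hv hcov (x := 0) (L := 0) ht (by simp)
  obtain ⟨r, hr, hmax⟩ := Set.exists_max_image _ id hfin ⟨_, i, j, hi, hiN, hrev, hsp, rfl⟩
  refine ⟨r, ⟨hr, hmax⟩, ?_⟩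
  obtain ⟨i, j, -, -, hrev, -, rfl⟩ := hr
  rw [← segCost_add_period c hper i]
  exact segCost_mono hnonneg f i (hrev.sub_le hper hv)

end Revisit

section OfList

variable {V : Type*}

/-- The periodic walk repeating a list. -/
def periodicWalk (d : V) (l : List V) (i : ℕ) : V := l.getD (i % l.length) d

variable {d : V} {l : List V}

lemma periodicWalk_of_lt {i : ℕ} (h : i < l.length) : periodicWalk d l i = l[i] := by
  rw [periodicWalk, Nat.mod_eq_of_lt h, List.getD_eq_getElem _ _ h]

lemma periodicWalk_add_length (i : ℕ) : periodicWalk d l (i + l.length) = periodicWalk d l i := by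
  simp [periodicWalk]

lemma stretch_periodicWalk : stretch (periodicWalk d l) 0 l.length = l := by
  apply List.ext_getElem (by simp)
  intro m h₁ h₂
  rw [getElem_stretch, Nat.zero_add, periodicWalk_of_lt h₂]

lemma stretch_periodicWalk_succ {x : V} :
    stretch (periodicWalk d (x :: l)) 0 ((x :: l).length + 1) = x :: l ++ [x] := by
  rw [stretch_add, stretch_periodicWalk, stretch_succ, periodicWalk_add_length,
    periodicWalk_of_lt (by simp)]
  rfl

lemma segCost_periodicWalk (c : V → V → ℝ) {x : V} :
    segCost c (periodicWalk d (x :: l)) 0 (x :: l).length = chainCost c (x :: l ++ [x]) := by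
  have := segCost_eq_chainCost c (periodicWalk d (x :: l)) 0 (x :: l).length
  rwa [stretch_periodicWalk_succ, Nat.zero_add] at this

lemma periodicWalk_mem (hl : l ≠ []) (i : ℕ) : periodicWalk d l i ∈ l := by
  have h := Nat.mod_lt i (List.length_pos_of_ne_nil hl)
  rw [periodicWalk, List.getD_eq_getElem _ _ h]
  exact List.getElem_mem h

lemma exists_periodicWalk_eq {t : V} (ht : t ∈ l) :
    ∃ i, i < l.length ∧ periodicWalk d l i = t := by
  obtain ⟨i, hi, rfl⟩ := List.getElem_of_mem ht
  exact ⟨i, hi, periodicWalk_of_lt hi⟩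

lemma periodicWalk_ne_succ {x : V} (h : (x :: l ++ [x]).IsChain (· ≠ ·)) (i : ℕ) :
    periodicWalk d (x :: l) i ≠ periodicWalk d (x :: l) (i + 1) := by
  have hmod : ∀ i, periodicWalk d (x :: l) (i % (x :: l).length) = periodicWalk d (x :: l) i :=
    (show Function.Periodic _ _ from periodicWalk_add_length).map_mod_nat
  have hsucc : periodicWalk d (x :: l) (i + 1) =
      periodicWalk d (x :: l) (i % (x :: l).length + 1) := by
    rw [← hmod (i + 1), ← Nat.mod_add_mod i _ 1, hmod]
  rw [hsucc, ← hmod i]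
  have hi := Nat.mod_lt i (List.length_pos_of_ne_nil (List.cons_ne_nil x l))
  generalize i % (x :: l).length = m at hi
  rw [← stretch_periodicWalk_succ (d := d), List.isChain_iff_getElem] at h
  have := h m (by rw [length_stretch]; omega)
  rwa [getElem_stretch, getElem_stretch, Nat.zero_add, Nat.zero_add] at this

lemma isPMPWalkFun_periodicWalk {N : Finset V} {x : V}
    (hchain : (x :: l ++ [x]).IsChain (· ≠ ·)) (hmem : ∀ t, t ∈ x :: l ↔ t ∈ N) :
    IsPMPWalkFun N (x :: l).length (periodicWalk d (x :: l)) :=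
  ⟨periodicWalk_add_length, periodicWalk_ne_succ hchain,
    fun i => (hmem _).1 (periodicWalk_mem (by simp) i),
    fun t ht => exists_periodicWalk_eq ((hmem t).2 ht)⟩

lemma isPMPDWalkFun_periodicWalk {N : Finset V}
    (hchain : (d :: l ++ [d]).IsChain (· ≠ ·)) (hd : d ∉ l) (hsub : ∀ t ∈ l, t ∈ N)
    (hcov : ∀ t ∈ N, t ∈ l) :
    IsPMPDWalkFun N d (d :: l).length (periodicWalk d (d :: l)) := by
  refine ⟨periodicWalk_add_length, periodicWalk_ne_succ hchain, fun i => ?_, fun i => ?_,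
    fun t ht => exists_periodicWalk_eq (List.mem_cons_of_mem d (hcov t ht))⟩
  · rw [Nat.dvd_iff_mod_eq_zero, periodicWalk]
    have hi := Nat.mod_lt i (List.length_pos_of_ne_nil (List.cons_ne_nil d l))
    rw [List.getD_eq_getElem _ _ hi]
    generalize i % (d :: l).length = m at hi
    rcases m with _ | m
    · simp
    · simp only [List.getElem_cons_succ, Nat.add_eq_zero_iff, one_ne_zero, and_false, iff_false]
      exact fun h => hd (h ▸ List.getElem_mem _)
  · rcases List.mem_cons.1 (periodicWalk_mem (d := d) (List.cons_ne_nil d l) i) with h | h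
    · exact Or.inr h
    · exact Or.inl (hsub _ h)

end OfList

section LowerBound

variable {V : Type*} [DecidableEq V] {N : Finset V} {dV : V} {p k : ℕ} {g : ℕ → V}

/-- A PMP-D walk with `p * n + 2` visits has `n` consecutive visits off the depot that miss a
target, or `n + 1` consecutive visits that miss a target. -/
lemma IsPMPDWalkFun.exists_gap (hg : IsPMPDWalkFun N dV k g) (hn : 2 ≤ N.card)
    (hp : 1 ≤ p) (hk : k = p * N.card + 2) :
    (∃ x, ∃ t ∈ N, 1 ≤ x ∧ x + N.card ≤ k ∧ ∀ m < N.card, g (x + m) ≠ t) ∨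
      ∃ x, ∃ t ∈ N, ∀ m < N.card + 1, g (x + m) ≠ t := by
  by_contra! h
  obtain ⟨h₁, h₂⟩ := h
  set n := N.card with hncard
  have hnk : n + 2 ≤ k := by nlinarith
  have himage : ∀ x, 1 ≤ x → x + n ≤ k → N = (Finset.range n).image fun m => g (x + m) := by
    intro x hx hxk
    refine Finset.eq_of_subset_of_card_le (fun t ht => ?_) ?_
    · obtain ⟨m, hm, hf⟩ := h₁ x t ht hx hxk
      exact Finset.mem_image.2 ⟨m, Finset.mem_range.2 hm, hf⟩
    · exact Finset.card_image_le.trans (by simp [hncard])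
  have hshift : ∀ x, 1 ≤ x → x + 1 + n ≤ k → g (x + n) = g x := by
    intro x hx hxk
    have hinj : Set.InjOn (fun m => g (x + m)) (Finset.range n) := by
      rw [← Finset.card_image_iff, ← himage x hx (by omega), Finset.card_range]
    have hxN : g x ∈ N := by
      rw [himage x hx (by omega)]
      exact Finset.mem_image.2 ⟨0, Finset.mem_range.2 (by omega), rfl⟩
    obtain ⟨m, hm, hf⟩ := h₁ (x + 1) (g x) hxN (by omega) (by omega)
    obtain hmn | hmn : m + 1 = n ∨ m + 1 < n := by omega
    · rwa [show x + n = x + 1 + m by omega]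
    · have : m + 1 = 0 := hinj (by simpa using hmn) (by simp; omega)
        (by simpa [show x + (m + 1) = x + 1 + m by omega] using hf)
      omega
  have hends : ∀ q ≤ p, g (1 + q * n) = g 1 := by
    intro q hq
    induction q with
    | zero => simp
    | succ q ih =>
      rw [← ih (by omega), show 1 + (q + 1) * n = 1 + q * n + n by ring]
      refine hshift _ (by omega) ?_
      have : (q + 1) * n ≤ p * n := Nat.mul_le_mul_right n hq
      rw [hk]
      linarith
  have hlast : g (k - 1) = g (k + 1) := by
    rw [show k - 1 = 1 + p * n by omega, hends p le_rfl, show k + 1 = 1 + k by omega, hg.1]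
  have hsub : N ⊆ (Finset.range (n - 1)).image fun m => g (k + 1 + m) := by
    intro t ht
    obtain ⟨m, hm, hf⟩ := h₂ (k - 1) t ht
    rw [Finset.mem_image]
    rcases m with _ | _ | m
    · exact ⟨0, Finset.mem_range.2 (by omega), by rw [← hf]; exact hlast.symm⟩
    · rw [show k - 1 + (0 + 1) = k by omega] at hf
      have hd : g k = dV := (hg.2.2.1 k).2 dvd_rfl
      obtain ⟨m, hm, hf'⟩ := h₁ 1 t ht le_rfl (by omega)
      rw [← hf, hd, hg.2.2.1] at hf'
      exact absurd (Nat.le_of_dvd (by omega) hf') (by omega)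
    · exact ⟨m, Finset.mem_range.2 (by omega), by
        rw [← hf, show k - 1 + (m + 1 + 1) = k + 1 + m by omega]⟩
  have := (Finset.card_le_card hsub).trans Finset.card_image_le
  rw [Finset.card_range] at this
  omega

/-- A PMP-D walk with `p * n + 2` visits has a spanning revisit sequence with at least `n + 2`
visits, or one with at least `n + 1` visits that avoids the depot. -/
lemma IsPMPDWalkFun.exists_long_spanning_revisit (hg : IsPMPDWalkFun N dV k g) (hd : dV ∉ N)
    (hn : 2 ≤ N.card) (hp : 1 ≤ p) (hk : k = p * N.card + 2) :
    ∃ i j, i < k ∧ g i ∈ N ∧ IsRevisit g i j ∧ Spans N g i j ∧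
      (i + (N.card + 2) ≤ j ∨
        i + (N.card + 1) ≤ j ∧ ∀ m, i ≤ m → m ≤ j → g m ≠ dV) := by
  by_cases hlong : ∃ x, ∃ t ∈ N, ∀ m < N.card + 1, g (x + m) ≠ t
  · obtain ⟨x, t, ht, hmiss⟩ := hlong
    obtain ⟨i, j, hi, hiN, hrev, hsp, hlen⟩ :=
      exists_spanning_revisit hg.1 (by omega) hg.2.2.2.2 ht hmiss
    exact ⟨i, j, hi, hiN, hrev, hsp, Or.inl (by omega)⟩
  · obtain ⟨x, t, ht, hx, hxk, hmiss⟩ := (hg.exists_gap hn hp hk).resolve_right hlong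
    push Not at hlong
    obtain ⟨y, rfl⟩ : ∃ y, x = y + 1 := ⟨x - 1, by omega⟩
    obtain ⟨hy, hrev, hsp⟩ := spanning_revisit_of_maximal_gap hlong ht hmiss
    refine ⟨y, _, by omega, hy ▸ ht, hrev, hsp, Or.inr ⟨by omega, fun m h₁ h₂ hm => ?_⟩⟩
    have hends : m ≠ y ∧ m ≠ y + 1 + N.card := by
      constructor
      · rintro rfl
        exact hd (hm ▸ hy ▸ ht)
      · rintro rfl
        exact hd (hm ▸ hrev.2.1 ▸ hy ▸ ht)
    have := Nat.le_of_dvd (by omega) ((hg.2.2.1 m).1 hm)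
    omega

/-- A revisit sequence with more than `A.card` visits, where `A` is the set of its interior visits
together with its terminus, can be shortcut to a closed sequence with `A.card + 1` visits. -/
lemma IsRevisit.exists_shortcut {c : V → V → ℝ} (htri : ∀ x y z, c x z ≤ c x y + c y z)
    {f : ℕ → V} (hne : ∀ i, f i ≠ f (i + 1)) {i j : ℕ} (h : IsRevisit f i j) {A : Finset V}
    (hA : ∀ t, t ∈ A ↔ ∃ m, i ≤ m ∧ m ≤ j ∧ f m = t) (hlen : i + (A.card + 1) ≤ j) :
    ∃ l : List V, l.Sublist (stretch f (i + 1) (j - i - 1)) ∧ f i ∉ l ∧ l.length = A.card ∧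
      (∀ t, t ∈ f i :: l ↔ t ∈ A) ∧ (f i :: l ++ [f i]).IsChain (· ≠ ·) ∧
      chainCost c (f i :: l ++ [f i]) ≤ segCost c f i j := by
  have hi : f i ∈ A := (hA _).2 ⟨i, le_rfl, h.1.le, rfl⟩
  have hApos : 0 < A.card := Finset.card_pos.2 ⟨_, hi⟩
  set l₀ := stretch f (i + 1) (j - i - 1) with hl₀
  have hset : l₀.toFinset = A.erase (f i) := by
    ext t
    rw [List.mem_toFinset, Finset.mem_erase, hA, hl₀, mem_stretch]
    constructor
    · rintro ⟨m, h₁, h₂, rfl⟩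
      exact ⟨h.2.2 m (by omega) (by omega), m, by omega, by omega, rfl⟩
    · rintro ⟨hti, m, h₁, h₂, rfl⟩
      have h₃ : m ≠ i := by rintro rfl; exact hti rfl
      have h₄ : m ≠ j := by rintro rfl; exact hti h.2.1
      exact ⟨m, by omega, by omega, rfl⟩
  have hcard : l₀.toFinset.card + 1 = A.card := by
    rw [hset, Finset.card_erase_add_one hi]
  have hdup : ¬ l₀.Nodup := fun hnd => by
    rw [List.toFinset_card_of_nodup hnd, hl₀, length_stretch] at hcard
    omega
  obtain ⟨l, hsub, hch, hll, heq⟩ :=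
    exists_sublist_length_eq_card_add_one (isChain_stretch hne _ _) hdup
  have hmem : ∀ t, t ∈ l ↔ t ≠ f i ∧ t ∈ A := by
    intro t
    rw [← List.mem_toFinset, heq, hset, Finset.mem_erase]
  have hnot : f i ∉ l := fun hm => ((hmem _).1 hm).1 rfl
  refine ⟨l, hsub, hnot, hll.trans hcard, fun t => ?_, ?_, ?_⟩
  · rw [List.mem_cons, hmem]
    by_cases ht : t = f i
    · simp [ht, hi]
    · simp [ht]
  · have hlne : l ≠ [] := by
      rintro rfl
      simp at hll
    exact isChain_cons_concat hch hlne hnot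
  · have hcost := segCost_eq_chainCost c f i (j - i)
    rw [h.stretch_eq (by omega), show i + (j - i) = j by have := h.1; omega] at hcost
    rw [hcost]
    exact chainCost_sublist_le htri hsub _ _

lemma le_segCost_of_no_depot {c : V → V → ℝ} (hnonneg : ∀ x y, 0 ≤ c x y)
    (htri : ∀ x y z, c x z ≤ c x y + c y z) (hg : IsPMPDWalkFun N dV k g)
    {R : ℝ} (hR : IsLeast (pmpRevTimes c N (N.card + 1)) R)
    {i j : ℕ} (hiN : g i ∈ N) (hrev : IsRevisit g i j) (hsp : Spans N g i j)
    (hlen : i + (N.card + 1) ≤ j) (hdep : ∀ m, i ≤ m → m ≤ j → g m ≠ dV) :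
    R ≤ segCost c g i j := by
  obtain ⟨l, -, -, hll, hmem, hchain, hcost⟩ := hrev.exists_shortcut htri hg.2.1 (A := N)
    (fun t => ⟨hsp t, fun ⟨m, h₁, h₂, hm⟩ =>
      hm ▸ (hg.2.2.2.1 m).resolve_right (hdep m h₁ h₂)⟩) hlen
  have hwalk := isPMPWalkFun_periodicWalk (d := dV) hchain hmem
  obtain ⟨r, hr, hrle⟩ := exists_isGreatest_revCosts hnonneg hwalk.1 (by simp) hwalk.2.2.2 ⟨_, hiN⟩
  rw [segCost_periodicWalk] at hrle
  rw [List.length_cons, hll] at hwalk hr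
  exact (hR.2 ⟨_, hwalk, hr⟩).trans (hrle.trans hcost)

lemma le_segCost_of_depot {c : V → V → ℝ} (hnonneg : ∀ x y, 0 ≤ c x y)
    (htri : ∀ x y z, c x z ≤ c x y + c y z) (hg : IsPMPDWalkFun N dV k g) (hd : dV ∉ N)
    {R : ℝ} (hR : IsLeast (pmpdRevTimes c N dV (N.card + 2)) R)
    {i j : ℕ} (hiN : g i ∈ N) (hrev : IsRevisit g i j) (hsp : Spans N g i j)
    (hlen : i + (N.card + 2) ≤ j) (hjk : j ≤ i + k)
    (hdep : ∃ m, i ≤ m ∧ m ≤ j ∧ g m = dV) :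
    R ≤ segCost c g i j := by
  have hcard : (insert dV N).card = N.card + 1 := Finset.card_insert_of_notMem hd
  obtain ⟨l, hsub, hil, hll, hmem, hchain, hcost⟩ :=
    hrev.exists_shortcut htri hg.2.1 (A := insert dV N)
      (fun t => by
        rw [Finset.mem_insert]
        constructor
        · rintro (rfl | ht)
          · exact hdep
          · exact hsp t ht
        · rintro ⟨m, h₁, h₂, rfl⟩
          exact (hg.2.2.2.1 m).symm) (by omega)
  have hne : g i ≠ dV := fun h => hd (h ▸ hiN)
  obtain ⟨P, Q, rfl⟩ : ∃ P Q, l = P ++ dV :: Q := by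
    refine List.append_of_mem ?_
    exact (List.mem_cons.1 ((hmem dV).2 (Finset.mem_insert_self _ _))).resolve_left hne.symm
  have honce : (stretch g (i + 1) (j - i - 1)).count dV ≤ 1 := by
    obtain ⟨m, h₁, h₂, hm⟩ := hdep
    have h₃ : m ≠ i := by rintro rfl; exact hne hm
    have h₄ : m ≠ j := by rintro rfl; exact hne (hrev.2.1 ▸ hm)
    rw [show j - i - 1 = (m - i - 1) + ((j - m - 1) + 1) by omega, stretch_add, stretch_succ,
      show i + 1 + (m - i - 1) = m by omega, hm, List.count_append, List.count_cons_self,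
      List.count_eq_zero_of_not_mem, List.count_eq_zero_of_not_mem]
    · intro h
      obtain ⟨m', h₅, h₆, hm'⟩ := mem_stretch.1 h
      have := Nat.le_of_dvd (by omega)
        (Nat.dvd_sub ((hg.2.2.1 m').1 hm') ((hg.2.2.1 m).1 hm))
      omega
    · intro h
      obtain ⟨m', h₅, h₆, hm'⟩ := mem_stretch.1 h
      have := Nat.le_of_dvd (by omega)
        (Nat.dvd_sub ((hg.2.2.1 m).1 hm) ((hg.2.2.1 m').1 hm'))
      omega
  have hcount := (hsub.count_le dV).trans honce
  rw [List.count_append, List.count_cons_self] at hcount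
  have hdQP : dV ∉ Q ++ g i :: P := by
    have hP : dV ∉ P := List.count_eq_zero.1 (by omega)
    have hQ : dV ∉ Q := List.count_eq_zero.1 (by omega)
    simp [hP, hQ, hne.symm]
  have hmem' : ∀ t, t ∈ dV :: (Q ++ g i :: P) ↔ t ∈ insert dV N := fun t => by
    rw [← hmem]
    simp only [List.mem_cons, List.mem_append]
    tauto
  have hwalk := isPMPDWalkFun_periodicWalk (N := N) (isChain_rotate hchain) hdQP
    (fun t ht => (Finset.mem_insert.1 ((hmem' t).1 (List.mem_cons_of_mem _ ht))).resolve_left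
      fun h => hdQP (h ▸ ht))
    (fun t ht => (List.mem_cons.1 ((hmem' t).2 (Finset.mem_insert_of_mem ht))).resolve_left
      fun h => hd (h ▸ ht))
  obtain ⟨r, hr, hrle⟩ := exists_isGreatest_revCosts hnonneg hwalk.1 (by simp) hwalk.2.2.2.2
    ⟨_, hiN⟩
  rw [segCost_periodicWalk, chainCost_rotate] at hrle
  have hlen' : (dV :: (Q ++ g i :: P)).length = N.card + 2 := by
    simp only [List.length_append, List.length_cons] at hll ⊢
    omega
  rw [hlen'] at hwalk hr
  exact (hR.2 ⟨_, hwalk, hr⟩).trans (hrle.trans hcost)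

/-- A PMP-D walk with `p * n + 2` visits has a spanning revisit sequence of cost at least
`RD*(n+2)`; moreover either its cost is at least `R*(n+1)` or it has at least `n + 2` visits. -/
lemma IsPMPDWalkFun.exists_costly_revisit {c : V → V → ℝ} (hnonneg : ∀ x y, 0 ≤ c x y)
    (htri : ∀ x y z, c x z ≤ c x y + c y z) (hg : IsPMPDWalkFun N dV k g) (hd : dV ∉ N)
    (hn : 2 ≤ N.card) (hp : 1 ≤ p) (hk : k = p * N.card + 2) {R₁ R₂ : ℝ}
    (hR₁ : IsLeast (pmpRevTimes c N (N.card + 1)) R₁)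
    (hR₂ : IsLeast (pmpdRevTimes c N dV (N.card + 2)) R₂) (hlt : R₂ < R₁) :
    ∃ i j, segCost c g i j ∈ revCosts c N k g ∧ R₂ ≤ segCost c g i j ∧
      (R₂ < segCost c g i j ∨ i + (N.card + 2) ≤ j) := by
  obtain ⟨i, j, hi, hiN, hrev, hsp, hlen⟩ := hg.exists_long_spanning_revisit hd hn hp hk
  refine ⟨i, j, ⟨i, j, hi, hiN, hrev, hsp, rfl⟩, ?_⟩
  by_cases hdep : ∃ m, i ≤ m ∧ m ≤ j ∧ g m = dV
  · have hlong : i + (N.card + 2) ≤ j := by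
      rcases hlen with h | ⟨-, h⟩
      · exact h
      · obtain ⟨m, h₁, h₂, hm⟩ := hdep
        exact absurd hm (h m h₁ h₂)
    exact ⟨le_segCost_of_depot hnonneg htri hg hd hR₂ hiN hrev hsp hlong
      (hrev.sub_le hg.1 (by omega)) hdep, Or.inr hlong⟩
  · push Not at hdep
    have := le_segCost_of_no_depot hnonneg htri hg hR₁ hiN hrev hsp (by omega) hdep
    exact ⟨by linarith, Or.inl (by linarith)⟩

end LowerBound

section UpperBound

variable {V : Type*} [DecidableEq V] {c : V → V → ℝ} {d : V} {w : List V}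

/-- A revisit sequence starting in the first of two adjacent stretches costs at most as much as the
closed walk `d :: w`, if each of the stretches is `d :: w` or its shortcut `w.dedup`. -/
lemma IsRevisit.segCost_le_of_blocks (hnonneg : ∀ x y, 0 ≤ c x y)
    (htri : ∀ x y z, c x z ≤ c x y + c y z) {f : ℕ → V} {s y j : ℕ} {B₁ B₂ : List V}
    (hB₁ : B₁ = d :: w ∨ B₁ = w.dedup) (hB₂ : B₂ = d :: w ∨ B₂ = w.dedup)
    (h₁ : stretch f s B₁.length = B₁) (h₂ : stretch f (s + B₁.length) B₂.length = B₂)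
    (hy : y < B₁.length) (hne : f (s + y) ≠ d) (h : IsRevisit f (s + y) j) :
    segCost c f (s + y) j ≤ chainCost c (d :: w ++ [d]) := by
  have hget : B₁[y] = f (s + y) := by
    rw [← getElem_stretch f s B₁.length y (by simpa using hy)]
    simp only [h₁]
  set x := f (s + y) with hx
  have hxw : x ∈ w := by
    have hxB : x ∈ B₁ := hget ▸ List.getElem_mem hy
    rcases hB₁ with rfl | rfl
    · exact (List.mem_cons.1 hxB).resolve_left hne
    · exact List.mem_dedup.1 hxB
  obtain ⟨P, Q, hw, hxQ⟩ : ∃ P Q, w = P ++ x :: Q ∧ x ∉ Q := by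
    obtain ⟨A, B, hAB, hxA⟩ := List.eq_append_cons_of_mem (List.mem_reverse.2 hxw)
    refine ⟨B.reverse, A.reverse, ?_, by simpa using hxA⟩
    rw [← List.reverse_reverse w, hAB]
    simp
  obtain ⟨P', Q', hdedup, hP', hQ'⟩ := exists_dedup_append_cons P hxQ
  have hdec : ∀ B, B = d :: w ∨ B = w.dedup →
      ∃ P₁ Q₁, B = P₁ ++ x :: Q₁ ∧ P₁.Sublist (d :: P) ∧ Q₁.Sublist Q := by
    rintro B (rfl | rfl)
    · exact ⟨d :: P, Q, by rw [hw]; rfl, List.Sublist.refl _, List.Sublist.refl _⟩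
    · exact ⟨P', Q', by rw [hw, hdedup], hP'.cons d, hQ'⟩
  obtain ⟨P₁, Q₁, rfl, hP₁, hQ₁⟩ := hdec B₁ hB₁
  obtain ⟨P₂, Q₂, rfl, hP₂, -⟩ := hdec B₂ hB₂
  have hbound : ∀ l : List V, l.Sublist (Q ++ d :: P) → stretch f (s + y) (l.length + 2) =
      x :: l ++ [x] → segCost c f (s + y) j ≤ chainCost c (d :: w ++ [d]) := by
    intro l hl hst
    refine (h.segCost_le hnonneg hst).trans ((chainCost_sublist_le htri hl x x).trans ?_)
    rw [chainCost_rotate, hw]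
  rcases lt_trichotomy y P₁.length with hlt | rfl | hgt
  · rw [List.getElem_append_left hlt] at hget
    have hsplit : P₁ = P₁.take y ++ x :: P₁.drop (y + 1) := by
      rw [← hget, List.getElem_cons_drop, List.take_append_drop]
    have htake : (P₁.take y).length = y := by simp [hlt.le]
    refine hbound (P₁.drop (y + 1))
      (((List.drop_sublist _ _).trans hP₁).trans (List.sublist_append_right _ _)) ?_
    have hfull : P₁ ++ x :: Q₁ =
        P₁.take y ++ ((x :: P₁.drop (y + 1) ++ [x]) ++ Q₁) := by
      conv_lhs => rw [hsplit]
      simp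
    have := (stretch_eq_append (stretch_eq_append (h₁.trans hfull)).2).1
    rw [htake] at this
    simpa only [List.length_append, List.length_cons, List.length_nil, Nat.add_assoc] using this
  · exact hbound (Q₁ ++ P₂) (hQ₁.append hP₂) (stretch_append_cons h₁ h₂)
  · have hmem : x ∈ Q₁ := by
      obtain ⟨z, rfl⟩ : ∃ z, y = P₁.length + 1 + z := ⟨y - (P₁.length + 1), by omega⟩
      rw [← hget, List.getElem_append_right (by omega)]
      simp only [show P₁.length + 1 + z - P₁.length = z + 1 by omega, List.getElem_cons_succ]
      exact List.getElem_mem _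
    exact absurd (hQ₁.subset hmem) hxQ

/-- Every revisit sequence of the walk that follows `d :: w` by `q` copies of its shortcut costs at
most as much as the closed walk `d :: w`. -/
lemma IsRevisit.segCost_periodicWalk_le (hnonneg : ∀ x y, 0 ≤ c x y)
    (htri : ∀ x y z, c x z ≤ c x y + c y z) {q i j : ℕ} {l : List V}
    (hl : l = d :: w ++ (List.replicate q w.dedup).flatten)
    (hi : i < l.length) (hne : periodicWalk d l i ≠ d)
    (h : IsRevisit (periodicWalk d l) i j) :
    segCost c (periodicWalk d l) i j ≤ chainCost c (d :: w ++ [d]) := by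
  set f := periodicWalk d l
  have hst : stretch f 0 l.length = l := stretch_periodicWalk
  have hlen : l.length = (d :: w).length + q * w.dedup.length := by
    rw [hl, List.length_append]
    simp
  have hfirst : stretch f 0 (d :: w).length = d :: w := (stretch_eq_append (hst.trans hl)).1
  have hcopy : ∀ b < q,
      stretch f ((d :: w).length + b * w.dedup.length) w.dedup.length = w.dedup := by
    intro b hb
    have hrep : List.replicate q w.dedup =
        List.replicate b w.dedup ++ w.dedup :: List.replicate (q - b - 1) w.dedup := by
      rw [← List.replicate_succ, List.replicate_append_replicate]
      congr 1
      omega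
    have h₁ := (stretch_eq_append (hst.trans hl)).2
    rw [hrep, List.flatten_append, List.flatten_cons] at h₁
    have h₂ := (stretch_eq_append (stretch_eq_append h₁).2).1
    simpa using h₂
  have hblock : ∀ b ≤ q, ∃ B, (B = d :: w ∨ B = w.dedup) ∧
      stretch f ((d :: w).length + b * w.dedup.length) B.length = B := by
    intro b hb
    obtain hbq | rfl := hb.lt_or_eq
    · exact ⟨_, Or.inr rfl, hcopy b hbq⟩
    · refine ⟨_, Or.inl rfl, ?_⟩
      rw [← hlen]
      refine (stretch_congr fun m _ => ?_).trans hfirst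
      rw [Nat.zero_add, Nat.add_comm]
      exact periodicWalk_add_length m
  by_cases hiw : i < (d :: w).length
  · obtain ⟨B, hB, hBst⟩ := hblock 0 (Nat.zero_le q)
    have := IsRevisit.segCost_le_of_blocks (c := c) (s := 0) (y := i) (j := j) hnonneg htri
      (Or.inl rfl) hB hfirst (by simpa using hBst) hiw (by simpa using hne) (by simpa using h)
    simpa using this
  · obtain ⟨z, rfl⟩ := Nat.exists_eq_add_of_le (not_lt.1 hiw)
    have hz : z < w.dedup.length * q := by
      rw [hlen] at hi
      rw [Nat.mul_comm]
      omega
    have hpos : 0 < w.dedup.length := Nat.pos_of_mul_pos_right (Nat.zero_lt_of_lt hz)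
    have hb : z / w.dedup.length < q := Nat.div_lt_of_lt_mul hz
    have hdm := Nat.div_add_mod z w.dedup.length
    have hzlt := Nat.mod_lt z hpos
    generalize z / w.dedup.length = b at hb hdm
    generalize z % w.dedup.length = y at hzlt hdm
    obtain ⟨B, hB, hBst⟩ := hblock (b + 1) hb
    rw [Nat.succ_mul, ← Nat.add_assoc] at hBst
    rw [← hdm, Nat.mul_comm, ← Nat.add_assoc] at h hne ⊢
    exact h.segCost_le_of_blocks hnonneg htri (Or.inr rfl) hB (hcopy b hb) hBst hzlt hne

/-- A walk stays free of immediate repetitions when followed by copies of its shortcut. -/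
lemma isChain_append_flatten_replicate_dedup (hw : w.IsChain (· ≠ ·)) (hcard : 2 ≤ w.dedup.length)
    (q : ℕ) : (w ++ (List.replicate q w.dedup).flatten).IsChain (· ≠ ·) := by
  obtain ⟨v, z, rfl⟩ := w.eq_nil_or_concat'.resolve_left (by rintro rfl; simp at hcard)
  obtain ⟨P, Q, hdedup, -, hQ⟩ := exists_dedup_append_cons v (x := z) (Q := []) (by simp)
  obtain rfl := List.sublist_nil.1 hQ
  have hnd := (v ++ [z]).nodup_dedup
  rw [hdedup] at hnd hcard ⊢
  suffices h : (v ++ [z] ++ (List.replicate q (P ++ [z])).flatten).IsChain (· ≠ ·) ∧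
      (v ++ [z] ++ (List.replicate q (P ++ [z])).flatten).getLast? = some z from h.1
  induction q with
  | zero => simpa using hw
  | succ q ih =>
    rw [List.replicate_succ', List.flatten_append, ← List.append_assoc, List.flatten_singleton]
    refine ⟨List.isChain_append.2 ⟨ih.1, List.Pairwise.isChain hnd, ?_⟩, by
      rw [← List.append_assoc, List.getLast?_concat]⟩
    rw [ih.2]
    rintro x hx y hy rfl
    obtain rfl : z = x := by simpa using hx
    rcases P with _ | ⟨a, P⟩
    · simp at hcard
    · obtain rfl : a = z := by simpa using hy
      simp at hnd

end UpperBound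

/-- Theorem 3 of the paper: for `k = pn+2`, if `R*(n+1) > RD*(n+2)`,
then the `k`-visit walk formed by concatenating (a rotation of) an optimal
`(n+2)`-visit PMP-D walk `WD*(n+2)` with `p−1` copies of the `n`-visit cycle obtained
by shortcutting the repeated target and the depot from `WD*(n+2)` is a feasible PMP-D
walk whose revisit time equals `RD*(n+2)`; hence `RD*(pn+2) = RD*(n+2)`. -/
theorem O2_optimal {V : Type*} [DecidableEq V]
    (c : V → V → ℝ) (N : Finset V) (dV : V) (hd : dV ∉ N) (hn : 3 ≤ N.card)
    (hsymm : ∀ x y, c x y = c y x) (hnonneg : ∀ x y, 0 ≤ c x y)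
    (htri : ∀ x y z, c x z ≤ c x y + c y z)
    (p k : ℕ) (hp : 1 ≤ p) (hk : k = p * N.card + 2)
    (RD R : ℕ → ℝ)
    (hRDk : IsLeast (pmpdRevTimes c N dV k) (RD k))
    (hRD2 : IsLeast (pmpdRevTimes c N dV (N.card + 2)) (RD (N.card + 2)))
    (hR1 : IsLeast (pmpRevTimes c N (N.card + 1)) (R (N.card + 1)))
    (hgt : RD (N.card + 2) < R (N.card + 1))
    (f₂ : ℕ → V) (hf₂ : IsPMPDWalkFun N dV (N.card + 2) f₂)
    (hopt : IsGreatest (revCosts c N (N.card + 2) f₂) (RD (N.card + 2))) :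
    (∃ (f : ℕ → V) (r s : ℕ) (Ls : List V),
      Ls.length = N.card ∧
      Ls.Sublist (List.ofFn fun i : Fin (N.card + 2) => f₂ (r + i.val)) ∧
      dV ∉ Ls ∧ (∀ t ∈ N, t ∈ Ls) ∧
      (List.ofFn fun i : Fin k => f (s + i.val)) =
        (List.ofFn fun i : Fin (N.card + 2) => f₂ (r + i.val)) ++
          (List.replicate (p - 1) Ls).flatten ∧
      IsPMPDWalkFun N dV k f ∧
      IsGreatest (revCosts c N k f) (RD (N.card + 2))) ∧
    RD k = RD (N.card + 2) := by
  set n := N.card with hncard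
  set w := stretch f₂ 1 (n + 1) with hw
  have hfirst : stretch f₂ 0 (n + 2) = dV :: w := by
    rw [stretch_succ, (hf₂.2.2.1 0).2 (dvd_zero _)]
  have hclosed : stretch f₂ 0 (n + 2 + 1) = dV :: w ++ [dV] := by
    rw [stretch_add, hfirst, Nat.zero_add, stretch_succ, (hf₂.2.2.1 (n + 2)).2 dvd_rfl]
    rfl
  have hmem : ∀ t, t ∈ w ↔ t ∈ N := by
    intro t
    rw [hw, mem_stretch]
    constructor
    · rintro ⟨m, h₁, h₂, rfl⟩
      refine (hf₂.2.2.2.1 m).resolve_right fun h => ?_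
      have := Nat.le_of_dvd (by omega) ((hf₂.2.2.1 m).1 h)
      omega
    · intro ht
      obtain ⟨i, hi, rfl⟩ := hf₂.2.2.2.2 t ht
      have : i ≠ 0 := by
        rintro rfl
        exact hd ((hf₂.2.2.1 0).2 (dvd_zero _) ▸ ht)
      exact ⟨i, by omega, by omega, rfl⟩
  have hdw : dV ∉ w := fun h => hd ((hmem _).1 h)
  have hcard : w.dedup.length = n := by
    rw [← List.toFinset_card_of_nodup w.nodup_dedup, hncard]
    congr 1
    ext t
    rw [List.mem_toFinset, List.mem_dedup, hmem]
  have hcost : chainCost c (dV :: w ++ [dV]) ≤ RD (n + 2) := by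
    obtain ⟨i, j, hrev, hle, hor⟩ := hf₂.exists_costly_revisit hnonneg htri hd (by omega)
      le_rfl (by rw [Nat.one_mul]) hR1 hRD2 hgt
    have hup := hopt.2 hrev
    have hperiod := segCost_eq_chainCost c f₂ 0 (n + 2)
    rw [hclosed, Nat.zero_add, ← segCost_add_period c hf₂.1 i] at hperiod
    rw [← hperiod]
    exact (segCost_mono hnonneg f₂ i (hor.resolve_left hup.not_gt)).trans hup
  have hlower : ∀ {g : ℕ → V} {r : ℝ}, IsPMPDWalkFun N dV k g → IsGreatest (revCosts c N k g) r →
      RD (n + 2) ≤ r := by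
    intro g r hg hr
    obtain ⟨i, j, hrev, hle, -⟩ := hg.exists_costly_revisit hnonneg htri hd (by omega)
      hp hk hR1 hRD2 hgt
    exact hle.trans (hr.2 hrev)
  set copies := (List.replicate (p - 1) w.dedup).flatten with hcopies
  have hcopies_mem : ∀ t ∈ copies, t ∈ w := by
    intro t ht
    obtain ⟨l, hl, htl⟩ := List.mem_flatten.1 ht
    exact List.mem_dedup.1 (List.eq_of_mem_replicate hl ▸ htl)
  have hmem' : ∀ t ∈ w ++ copies, t ∈ w := fun t ht =>
    (List.mem_append.1 ht).elim id (hcopies_mem t)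
  have hlen : (dV :: (w ++ copies)).length = k := by
    obtain ⟨q, rfl⟩ : ∃ q, p = q + 1 := ⟨p - 1, by omega⟩
    simp only [hcopies, hw, List.length_cons, List.length_append, length_stretch,
      List.length_flatten, List.map_replicate, List.sum_replicate, smul_eq_mul]
    rw [← hw, hcard, hk, Nat.add_sub_cancel]
    ring
  have hwalk : IsPMPDWalkFun N dV k (periodicWalk dV (dV :: (w ++ copies))) := by
    rw [← hlen]
    refine isPMPDWalkFun_periodicWalk (isChain_cons_concat ?_ ?_ fun h => hdw (hmem' _ h))
      (fun h => hdw (hmem' _ h)) (fun t ht => (hmem t).1 (hmem' t ht))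
      fun t ht => List.mem_append_left _ ((hmem t).2 ht)
    · exact isChain_append_flatten_replicate_dedup (isChain_stretch hf₂.2.1 _ _)
        (hcard.symm ▸ by omega) _
    · simp [hw, stretch_succ]
  obtain ⟨r, hr, -⟩ := exists_isGreatest_revCosts hnonneg hwalk.1 (by omega) hwalk.2.2.2.2
    (Finset.card_pos.1 (by omega))
  have hupper : r ≤ RD (n + 2) := by
    obtain ⟨i, j, hi, hiN, hrev, -, rfl⟩ := hr.1
    exact (hrev.segCost_periodicWalk_le hnonneg htri (q := p - 1) (w := w) rfl
      (hlen.symm ▸ hi) (ne_of_mem_of_not_mem hiN hd)).trans hcost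
  obtain rfl : r = RD (n + 2) := le_antisymm hupper (hlower hwalk hr)
  refine ⟨⟨_, 0, 0, w.dedup, hcard, ?_, ?_, ?_, ?_, hwalk, hr⟩, ?_⟩
  · rw [ofFn_eq_stretch, hfirst]
    exact (List.dedup_sublist w).cons dV
  · simpa using hdw
  · simpa using fun t ht => (hmem t).2 ht
  · rw [ofFn_eq_stretch, ofFn_eq_stretch, hfirst, ← hlen, stretch_periodicWalk]
    rfl
  · obtain ⟨g, hg, hgr⟩ := hRDk.1
    exact le_antisymm (hRDk.2 ⟨_, hwalk, hr⟩) (hlower hg hgr)
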